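/- Let q be a positive integer, ι a (possibly infinite) nonempty type, and σ 1, …, σ q permutations of ι encoding a graph of profile type. Then an exact covering of the graph exists if and only if the total monodromy τ q = σ q ∘ ⋯ ∘ σ 1 is the identity permutation of ι. -/

import Mathlib

/-- Partial monodromy: `tau σ k = σ (k-1) ∘ ⋯ ∘ σ 0`, the composite of the first `k`
permutations (so with the paper's 1-based indexing, `tau σ k` is `τ k = σ k ∘ ⋯ ∘ σ 1`). -/
def tau {ι : Type*} (σ : ℕ → Equiv.Perm ι) : ℕ → Equiv.Perm ι
  | 0 => 1
  | k + 1 => σ k * tau σ k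

/-- Edge set of the covering path through `j`: the edges `(k, τ (k+1) j)` for positions
`k < q` (0-based positions; edge `(k, m)` is the edge of line `m` joining positions
`k` and `k+1`, indices mod `q`). -/
def edgeSet {ι : Type*} (q : ℕ) (σ : ℕ → Equiv.Perm ι) (j : ι) : Set (ℕ × ι) :=
  {e | e.1 < q ∧ e.2 = tau σ (e.1 + 1) j}

/-- A set `S` of lines gives an exact covering if every covering path through `j ∈ S` is
closed, every edge of the graph lies on some path of the family, and distinct paths of the
family share no edge. -/
def IsExactCovering {ι : Type*} (q : ℕ) (σ : ℕ → Equiv.Perm ι) (S : Set ι) : Prop :=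
  (∀ j ∈ S, tau σ q j = j) ∧
  (∀ e : ℕ × ι, e.1 < q → ∃ j ∈ S, e ∈ edgeSet q σ j) ∧
  (∀ j ∈ S, ∀ j' ∈ S, j ≠ j' → edgeSet q σ j ∩ edgeSet q σ j' = ∅)

/-- An exact covering of a graph of profile type exists iff the total monodromy
`τ q = σ q ∘ ⋯ ∘ σ 1` is the identity permutation. -/
theorem exists_exactCovering_iff_monodromy_eq_one
    {ι : Type*} [Nonempty ι] (q : ℕ) (hq : 0 < q) (σ : ℕ → Equiv.Perm ι) :
    (∃ S : Set ι, IsExactCovering q σ S) ↔ tau σ q = 1 := by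
  constructor
  · rintro ⟨S, hclosed, hcover, -⟩
    ext m
    obtain ⟨j, hj, -, hm⟩ := hcover (q - 1, m) (Nat.sub_lt hq one_pos)
    have hmj : m = j := by
      simpa only [Nat.sub_one_add_one hq.ne', hclosed j hj] using hm
    rw [hmj, hclosed j hj, Equiv.Perm.one_apply]
  · intro h
    refine ⟨Set.univ, fun j _ => by rw [h, Equiv.Perm.one_apply], fun e he => ?_,
      fun j _ j' _ hne => ?_⟩
    · exact ⟨(tau σ (e.1 + 1)).symm e.2, Set.mem_univ _, he,
        ((tau σ (e.1 + 1)).apply_symm_apply e.2).symm⟩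
    · refine Set.eq_empty_of_forall_notMem fun e he => hne ?_
      exact (tau σ (e.1 + 1)).injective (he.1.2.symm.trans he.2.2)
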